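/- In d = 3, there exists a constant C > 0 such that for all R ≥ 1, the Brownian loop measure of the set of loops with diameter at least 1 that intersect the sphere ∂B(0,R) is at most C·R². -/

import Mathlib

open MeasureTheory Real

/-- Borel σ-algebra on the space of continuous paths `C(ℝ, ℝ^d)` (compact-open topology). -/
noncomputable instance pathSpaceMeasurableSpace (d : ℕ) :
    MeasurableSpace C(ℝ, EuclideanSpace ℝ (Fin d)) := borel _

/-- The heat kernel `p_t(x,y) = (2πt)^{-d/2} exp(-‖x-y‖²/(2t))` in `ℝ^d`. -/
noncomputable def heatKernel (d : ℕ) (t : ℝ) (x y : EuclideanSpace ℝ (Fin d)) : ℝ :=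
  (2 * π * t) ^ (-(d:ℝ)/2) * Real.exp (-‖x - y‖ ^ 2 / (2 * t))

/-- `Q` is the law `P^{x,x;T}` of the Brownian bridge of duration `T` from `x` to `x` in
`ℝ^d`, viewed as a probability measure on continuous paths which sit at `x` outside `(0, T)`:
its finite-dimensional distributions at times `0 < t₁ < ⋯ < t_k < T` have density
`(2πT)^{d/2} ∏_{j=0}^k p_{t_{j+1}−t_j}(z_j, z_{j+1})` (with `t₀ = 0`, `t_{k+1} = T`,
`z₀ = z_{k+1} = x`) with respect to Lebesgue measure. -/
def IsBrownianBridge (d : ℕ) (x : EuclideanSpace ℝ (Fin d)) (T : ℝ)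
    (Q : Measure C(ℝ, EuclideanSpace ℝ (Fin d))) : Prop :=
  IsProbabilityMeasure Q ∧
  (∀ᵐ w ∂Q, w 0 = x ∧ ∀ s : ℝ, s ∉ Set.Ioo 0 T → w s = x) ∧
  ∀ (k : ℕ) (t : Fin k → ℝ), StrictMono t → (∀ j, t j ∈ Set.Ioo 0 T) →
    Q.map (fun w => fun j => w (t j))
      = (Measure.pi fun _ : Fin k => (volume : Measure (EuclideanSpace ℝ (Fin d)))).withDensity
          (fun z =>
            let tt : Fin (k+2) → ℝ := Fin.snoc (Fin.cons 0 t) T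
            let zz : Fin (k+2) → EuclideanSpace ℝ (Fin d) := Fin.snoc (Fin.cons x z) x
            ENNReal.ofReal ((2 * π * T) ^ ((d:ℝ)/2) *
              ∏ j : Fin (k+1), heatKernel d (tt j.succ - tt j.castSucc) (zz j.castSucc) (zz j.succ)))

/-- `μ` is the Brownian loop measure in `ℝ³`:
`μ^loop = ∫_{ℝ³} dx ∫₀^∞ (dt/t) (2πt)^{−3/2} P^{x,x;t}`, where `Q x t = P^{x,x;t}` is the
Brownian bridge of duration `t` from `x` to `x`. -/
def IsBrownianLoopMeasure (μ : Measure C(ℝ, EuclideanSpace ℝ (Fin 3))) : Prop :=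
  ∃ Q : EuclideanSpace ℝ (Fin 3) → ℝ → Measure C(ℝ, EuclideanSpace ℝ (Fin 3)),
    (∀ x t, 0 < t → IsBrownianBridge 3 x t (Q x t)) ∧
    ∀ A : Set C(ℝ, EuclideanSpace ℝ (Fin 3)), MeasurableSet A →
      μ A = ∫⁻ x, ∫⁻ t in Set.Ioi (0:ℝ),
        ENNReal.ofReal (t⁻¹ * (2 * π * t) ^ (-(3:ℝ)/2)) * Q x t A ∂volume ∂volume


/-- three dimensional Euclidean space -/
abbrev E3 : Type := EuclideanSpace ℝ (Fin 3)

instance pathBorel (d : ℕ) : BorelSpace C(ℝ, EuclideanSpace ℝ (Fin d)) := ⟨rfl⟩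

lemma measurable_path_eval (s : ℝ) : Measurable (fun w : C(ℝ, E3) => w s) :=
  (ContinuousEvalConst.continuous_eval_const s).measurable

lemma measurable_path_coe : Measurable (fun w : C(ℝ, E3) => (fun s : ℝ => w s)) :=
  measurable_pi_lambda _ measurable_path_eval

lemma bridge_map_eq {x : E3} {T : ℝ} {Q Q' : Measure C(ℝ, E3)}
    (h : IsBrownianBridge 3 x T Q) (h' : IsBrownianBridge 3 x T Q') :
    Q.map (fun w : C(ℝ, E3) => (fun s : ℝ => w s)) =
      Q'.map (fun w : C(ℝ, E3) => (fun s : ℝ => w s)) := by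
  classical
  have hP := h.1
  have hP' := h'.1
  have key : ∀ I : Finset ℝ, Q.map (fun w : C(ℝ, E3) => I.restrict (fun s : ℝ => w s)) =
      Q'.map (fun w : C(ℝ, E3) => I.restrict (fun s : ℝ => w s)) := by
    intro I
    set J : Finset ℝ := I.filter (fun s => s ∈ Set.Ioo 0 T) with hJ
    set t : Fin J.card → ℝ := fun j => J.orderEmbOfFin rfl j with ht
    have htm : StrictMono t := (J.orderEmbOfFin rfl).strictMono
    have htI : ∀ j, t j ∈ Set.Ioo 0 T := by
      intro j
      have : t j ∈ J := Finset.orderEmbOfFin_mem J rfl j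
      rw [hJ, Finset.mem_filter] at this
      exact this.2
    have hidx : ∀ s : ℝ, s ∈ J → ∃ j, t j = s := by
      intro s hs
      have : s ∈ Set.range (J.orderEmbOfFin rfl) := by
        rw [Finset.range_orderEmbOfFin]; exact hs
      exact this
    choose idx hidx using hidx
    let Ψ : (Fin J.card → E3) → (I → E3) := fun z s => if hs : (s : ℝ) ∈ J then z (idx s hs) else x
    have hΨ : Measurable Ψ := by
      refine measurable_pi_lambda _ fun s => ?_
      by_cases hs : (s : ℝ) ∈ J
      · simp only [Ψ, hs, dif_pos]
        exact measurable_pi_apply _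
      · simp only [Ψ, hs]
        exact measurable_const
    have main : ∀ Q : Measure C(ℝ, E3), IsBrownianBridge 3 x T Q →
        Q.map (fun w : C(ℝ, E3) => I.restrict (fun s : ℝ => w s)) =
          (Q.map (fun w => fun j => w (t j))).map Ψ := by
      intro Q h
      rw [Measure.map_map hΨ (measurable_pi_lambda _ fun j => measurable_path_eval _)]
      refine Measure.map_congr ?_
      filter_upwards [h.2.1] with w hw
      funext s
      by_cases hs : (s : ℝ) ∈ J
      · simp only [Ψ, hs, dif_pos, Function.comp, Finset.restrict]
        rw [hidx]
      · simp only [Ψ, hs, Function.comp, Finset.restrict]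
        have : (s : ℝ) ∉ Set.Ioo 0 T := fun h0 => hs (Finset.mem_filter.2 ⟨s.2, h0⟩)
        simpa using hw.2 s this
    rw [main Q h, main Q' h', h.2.2 _ t htm htI, h'.2.2 _ t htm htI]
  have h1 := ProbabilityTheory.isProjectiveLimit_map (P := Q)
    (X := fun (s : ℝ) (w : C(ℝ, E3)) => w s) measurable_path_coe.aemeasurable
  have h2 := ProbabilityTheory.isProjectiveLimit_map (P := Q')
    (X := fun (s : ℝ) (w : C(ℝ, E3)) => w s) measurable_path_coe.aemeasurable
  simp_rw [← key] at h2
  exact h1.unique h2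

/-- Brownian scaling and translation of paths. -/
noncomputable def scalePath (x : E3) (T : ℝ) (w : C(ℝ, E3)) : C(ℝ, E3) :=
  ⟨fun s => x + √T • w (s / T), by fun_prop⟩

lemma scalePath_apply (x : E3) (T : ℝ) (w : C(ℝ, E3)) (s : ℝ) :
    scalePath x T w s = x + √T • w (s / T) := rfl

lemma measurable_scalePath (x : E3) (T : ℝ) : Measurable (scalePath x T) := by
  apply Continuous.measurable
  apply ContinuousMap.continuous_of_continuous_uncurry
  simp only [Function.uncurry_def, scalePath_apply]
  fun_prop

lemma lintegral_affine (k : ℕ) (x : Fin k → E3) {a : ℝ} (ha : 0 < a)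
    {F : (Fin k → E3) → ENNReal} (hF : Measurable F) :
    ∫⁻ z, F (x + a • z) = ENNReal.ofReal ((a ^ (3 * k))⁻¹) * ∫⁻ z, F z := by
  have h1 : ∫⁻ z, F (x + a • z) = ∫⁻ z, F (x + z) ∂(Measure.map (a • ·) volume) := by
    rw [lintegral_map (by fun_prop) (by fun_prop)]
  rw [h1, Measure.map_addHaar_smul _ ha.ne', lintegral_smul_measure, smul_eq_mul,
    lintegral_add_left_eq_self F x]
  congr 2
  rw [abs_of_pos (by positivity)]
  have : Module.finrank ℝ (Fin k → E3) = 3 * k := by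
    rw [Module.finrank_pi_fintype]; simp [mul_comm]
  rw [this]

lemma heatKernel_scale {T : ℝ} (hT : 0 < T) {τ : ℝ} (hτ : 0 ≤ τ) (x a b : E3) :
    heatKernel 3 (T * τ) (x + √T • a) (x + √T • b) = (√T ^ 3)⁻¹ * heatKernel 3 τ a b := by
  unfold heatKernel
  have h1 : x + √T • a - (x + √T • b) = √T • (a - b) := by rw [smul_sub]; abel
  rw [h1, norm_smul, Real.norm_of_nonneg (Real.sqrt_nonneg _), mul_pow, Real.sq_sqrt hT.le]
  have h2 : -(T * ‖a - b‖ ^ 2) / (2 * (T * τ)) = -‖a - b‖ ^ 2 / (2 * τ) := by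
    rw [neg_div, neg_div, show 2 * (T * τ) = T * (2 * τ) by ring, mul_div_mul_left _ _ hT.ne']
  rw [h2, show 2 * π * (T * τ) = T * (2 * π * τ) by ring, Real.mul_rpow hT.le (by positivity)]
  have h3 : T ^ (-((3:ℕ):ℝ)/2) = (√T ^ 3)⁻¹ := by
    rw [Real.sqrt_eq_rpow, ← Real.rpow_natCast, ← Real.rpow_mul hT.le, ← Real.rpow_neg hT.le]
    norm_num
  rw [h3]; ring

lemma snoc_cons_comp {α β : Type*} (f : α → β) (k : ℕ) (a b : α) (t : Fin k → α)
    (i : Fin (k + 2)) :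
    (Fin.snoc (Fin.cons (f a) (fun j => f (t j)) : Fin (k + 1) → β) (f b) : Fin (k + 2) → β) i =
      f ((Fin.snoc (Fin.cons a t : Fin (k + 1) → α) b : Fin (k + 2) → α) i) := by
  refine Fin.lastCases ?_ (fun i => ?_) i
  · simp
  · simp only [Fin.snoc_castSucc]
    refine Fin.cases ?_ (fun i => ?_) i
    · simp
    · simp

lemma snoc_cons_diff (k : ℕ) (t : Fin k → ℝ) (ht : StrictMono t)
    (htI : ∀ j, t j ∈ Set.Ioo (0:ℝ) 1) (j : Fin (k + 1)) :
    0 ≤ (Fin.snoc (Fin.cons 0 t : Fin (k + 1) → ℝ) 1 : Fin (k + 2) → ℝ) j.succ -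
      (Fin.snoc (Fin.cons 0 t : Fin (k + 1) → ℝ) 1 : Fin (k + 2) → ℝ) j.castSucc := by
  rw [sub_nonneg, Fin.snoc_castSucc]
  refine Fin.lastCases ?_ (fun i => ?_) j
  · rw [Fin.succ_last, Fin.snoc_last]
    refine Fin.cases ?_ (fun i => ?_) (Fin.last k)
    · simp
    · simpa using (htI i).2.le
  · rw [Fin.succ_castSucc, Fin.snoc_castSucc, Fin.cons_succ]
    rcases Fin.eq_zero_or_eq_succ i.castSucc with h | ⟨i', h⟩
    · rw [h]; simpa using (htI i).1.le
    · rw [h, Fin.cons_succ]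
      apply ht.monotone
      have : (i.castSucc : ℕ) = (i'.succ : ℕ) := by rw [h]
      simp at this
      rw [Fin.le_def]; omega

lemma bridge_scale {Q : Measure C(ℝ, E3)} (hQ : IsBrownianBridge 3 0 1 Q) (x : E3) {T : ℝ}
    (hT : 0 < T) : IsBrownianBridge 3 x T (Q.map (scalePath x T)) := by
  obtain ⟨hP, hae, hfdd⟩ := hQ
  have hm := measurable_scalePath x T
  refine ⟨Measure.isProbabilityMeasure_map hm.aemeasurable, ?_, ?_⟩
  · have : ∀ᵐ w ∂Q, (scalePath x T w) 0 = x ∧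
        ∀ s : ℝ, s ∉ Set.Ioo 0 T → (scalePath x T w) s = x := by
      filter_upwards [hae] with w hw
      refine ⟨by simp [scalePath_apply, hw.1], fun s hs => ?_⟩
      have : s / T ∉ Set.Ioo (0:ℝ) 1 := by
        intro h
        refine hs ⟨?_, ?_⟩
        · have := h.1; rwa [lt_div_iff₀ hT, zero_mul] at this
        · have := h.2; rwa [div_lt_one hT] at this
      simp [scalePath_apply, hw.2 _ this]
    have hset : MeasurableSet {w : C(ℝ, E3) | w 0 = x ∧ ∀ s : ℝ, s ∉ Set.Ioo 0 T → w s = x} := by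
      apply IsClosed.measurableSet
      simp only [Set.ofPred_and, Set.ofPred_forall]
      refine IsClosed.inter (isClosed_eq (by fun_prop) (by fun_prop)) ?_
      exact isClosed_iInter fun s => isClosed_iInter fun _ =>
        isClosed_eq (by fun_prop) (by fun_prop)
    rw [ae_map_iff hm.aemeasurable hset]
    exact this
  · intro k t ht htI
    have htm : StrictMono (fun j => t j / T) := fun i j hij => by
      have := ht hij
      simp only
      gcongr
    have htI' : ∀ j, t j / T ∈ Set.Ioo (0:ℝ) 1 := fun j =>
      ⟨div_pos (htI j).1 hT, (div_lt_one hT).2 (htI j).2⟩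
    have h1 := hfdd k _ htm htI'
    have hmap : (Q.map (scalePath x T)).map (fun w => fun j => w (t j)) =
        (Q.map (fun w => fun j => w (t j / T))).map (fun z => (fun _ => x) + √T • z) := by
      rw [Measure.map_map (measurable_pi_lambda _ fun j => measurable_path_eval _) hm,
        Measure.map_map (by fun_prop) (measurable_pi_lambda _ fun j => measurable_path_eval _)]
      rfl
    rw [hmap, h1]
    set d1 : (Fin k → E3) → ENNReal := fun z =>
            let tt : Fin (k+2) → ℝ := Fin.snoc (Fin.cons 0 (fun j => t j / T)) 1
            let zz : Fin (k+2) → E3 := Fin.snoc (Fin.cons 0 z) 0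
            ENNReal.ofReal ((2 * π * 1) ^ (((3:ℕ):ℝ)/2) *
              ∏ j : Fin (k+1), heatKernel 3 (tt j.succ - tt j.castSucc)
                (zz j.castSucc) (zz j.succ)) with hd1
    set d2 : (Fin k → E3) → ENNReal := fun z =>
            let tt : Fin (k+2) → ℝ := Fin.snoc (Fin.cons 0 t) T
            let zz : Fin (k+2) → E3 := Fin.snoc (Fin.cons x z) x
            ENNReal.ofReal ((2 * π * T) ^ (((3:ℕ):ℝ)/2) *
              ∏ j : Fin (k+1), heatKernel 3 (tt j.succ - tt j.castSucc)
                (zz j.castSucc) (zz j.succ)) with hd2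
    have hsT : 0 < √T := Real.sqrt_pos.2 hT
    have hd : ∀ z, d1 z = ENNReal.ofReal (√T ^ (3 * k)) * d2 ((fun _ => x) + √T • z) := by
      intro z
      simp only [hd1, hd2]
      rw [← ENNReal.ofReal_mul (by positivity)]
      congr 1
      have e1 : ∀ i, (Fin.snoc (Fin.cons 0 t : Fin (k + 1) → ℝ) T : Fin (k + 2) → ℝ) i =
          T * (Fin.snoc (Fin.cons 0 (fun j => t j / T) : Fin (k + 1) → ℝ) 1 :
            Fin (k + 2) → ℝ) i := by
        intro i
        rw [← snoc_cons_comp (fun y => T * y)]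
        simp [mul_div_cancel₀ _ hT.ne']
      have e2 : ∀ i, (Fin.snoc (Fin.cons x ((fun _ => x) + √T • z) : Fin (k + 1) → E3) x :
          Fin (k + 2) → E3) i =
          x + √T • (Fin.snoc (Fin.cons 0 z : Fin (k + 1) → E3) 0 : Fin (k + 2) → E3) i := by
        intro i
        rw [← snoc_cons_comp (fun y => x + √T • y)]
        simp only [smul_zero, add_zero]
        rfl
      simp only [e1, e2, ← mul_sub]
      have e3 : ∀ j : Fin (k + 1), _ := fun j => heatKernel_scale hT
        (snoc_cons_diff k _ htm htI' j) x
        ((Fin.snoc (Fin.cons 0 z : Fin (k + 1) → E3) 0 : Fin (k + 2) → E3) j.castSucc)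
        ((Fin.snoc (Fin.cons 0 z : Fin (k + 1) → E3) 0 : Fin (k + 2) → E3) j.succ)
      rw [Finset.prod_congr rfl (fun j _ => e3 j), Finset.prod_mul_distrib, Finset.prod_const,
        Finset.card_univ, Fintype.card_fin, Real.mul_rpow (by positivity) hT.le, mul_one]
      have e4 : T ^ (((3:ℕ):ℝ)/2) = √T ^ 3 := by
        rw [Real.sqrt_eq_rpow, ← Real.rpow_natCast, ← Real.rpow_mul hT.le]
        norm_num
      rw [e4]
      generalize (∏ j : Fin (k + 1), _ : ℝ) = P
      rw [inv_pow, ← pow_mul, show 3 * (k + 1) = 3 * k + 3 by ring, pow_add]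
      field_simp
    have hc1 : ∀ i, Continuous (fun z : Fin k → E3 =>
        (Fin.snoc (Fin.cons x z : Fin (k + 1) → E3) x : Fin (k + 2) → E3) i) := by
      intro i
      refine Fin.lastCases ?_ (fun i => ?_) i
      · simp only [Fin.snoc_last]; fun_prop
      · simp only [Fin.snoc_castSucc]
        refine Fin.cases ?_ (fun i => ?_) i
        · simp only [Fin.cons_zero]; fun_prop
        · simp only [Fin.cons_succ]; fun_prop
    have hd2m : Measurable d2 := by
      apply ENNReal.measurable_ofReal.comp
      apply Continuous.measurable
      simp only [heatKernel]
      fun_prop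
    rw [← volume_pi]
    ext s hs
    have hg : Measurable (fun z : Fin k → E3 => (fun _ => x) + √T • z) := by fun_prop
    rw [Measure.map_apply hg hs, withDensity_apply _ (hg hs), withDensity_apply _ hs,
      ← lintegral_indicator (hg hs), ← lintegral_indicator hs]
    have e5 : ∀ z, ((fun z : Fin k → E3 => (fun _ => x) + √T • z) ⁻¹' s).indicator d1 z =
        ENNReal.ofReal (√T ^ (3 * k)) * s.indicator d2 ((fun _ => x) + √T • z) := by
      intro z
      by_cases hz : (fun _ => x) + √T • z ∈ s
      · rw [Set.indicator_of_mem hz, Set.indicator_of_mem (by exact hz), hd]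
      · rw [Set.indicator_of_notMem hz, Set.indicator_of_notMem (by exact hz), mul_zero]
    have hm5 : Measurable (fun z : Fin k → E3 => s.indicator d2 ((fun _ => x) + √T • z)) :=
      (hd2m.indicator hs).comp hg
    rw [lintegral_congr e5, lintegral_const_mul _ hm5,
      lintegral_affine k (fun _ => x) hsT (hd2m.indicator hs), ← mul_assoc,
      ← ENNReal.ofReal_mul (by positivity), mul_inv_cancel₀ (by positivity), ENNReal.ofReal_one,
      one_mul]

lemma heatKernel_nonneg {τ : ℝ} (hτ : 0 < τ) (a b : E3) : 0 ≤ heatKernel 3 τ a b := by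
  unfold heatKernel; positivity

lemma heatKernel_symm (τ : ℝ) (a b : E3) : heatKernel 3 τ a b = heatKernel 3 τ b a := by
  unfold heatKernel; rw [norm_sub_rev]

lemma measurable_heatKernel (τ : ℝ) : Measurable (fun p : E3 × E3 => heatKernel 3 τ p.1 p.2) := by
  unfold heatKernel
  apply Continuous.measurable
  fun_prop

lemma measurable_heatKernel_left (τ : ℝ) (b : E3) :
    Measurable (fun a : E3 => ENNReal.ofReal (heatKernel 3 τ a b)) := by
  unfold heatKernel
  apply ENNReal.measurable_ofReal.comp
  apply Continuous.measurable
  fun_prop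

lemma lintegral_heatKernel {τ : ℝ} (hτ : 0 < τ) (b : E3) :
    ∫⁻ a, ENNReal.ofReal (heatKernel 3 τ a b) = 1 := by
  have h0 : ∫⁻ a, ENNReal.ofReal (heatKernel 3 τ a b) =
      ∫⁻ a, ENNReal.ofReal (heatKernel 3 τ a 0) := by
    rw [← lintegral_sub_right_eq_self (fun a => ENNReal.ofReal (heatKernel 3 τ a 0)) b]
    simp [heatKernel]
  have hb : 0 < 1 / (2 * τ) := by positivity
  have h1 := GaussianFourier.integral_rexp_neg_mul_sq_norm (V := E3) hb
  have hne : (π / (1 / (2 * τ))) ^ ((Module.finrank ℝ E3 : ℝ) / 2) ≠ 0 := by positivity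
  have hgauss : Integrable (fun v : E3 => rexp (-(1 / (2 * τ)) * ‖v‖ ^ 2)) := by
    by_contra h
    rw [integral_undef h] at h1
    exact hne h1.symm
  have h2 : ∀ a : E3, heatKernel 3 τ a 0 =
      (2 * π * τ) ^ (-((3:ℕ):ℝ)/2) * rexp (-(1 / (2 * τ)) * ‖a‖ ^ 2) := by
    intro a
    unfold heatKernel
    congr 2
    rw [sub_zero]; field_simp
  rw [h0, ← ofReal_integral_eq_lintegral_ofReal]
  · simp_rw [h2]
    rw [integral_const_mul, h1]
    have : π / (1 / (2 * τ)) = 2 * π * τ := by field_simp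
    rw [this, ← Real.rpow_add (by positivity)]
    simp [neg_div]
  · simp_rw [h2]
    exact hgauss.const_mul _
  · exact Filter.Eventually.of_forall fun a => heatKernel_nonneg hτ a 0

/-- moment constant -/
def momC : ℝ := 720 * 4 ^ 6 * 4

lemma momC_pos : 0 < momC := by unfold momC; norm_num

lemma heatKernel_moment {τ : ℝ} (hτ : 0 < τ) (a b : E3) :
    ‖b - a‖ ^ 12 * heatKernel 3 τ a b ≤ momC * τ ^ 6 * heatKernel 3 (2 * τ) a b := by
  unfold heatKernel
  rw [norm_sub_rev b a]
  set y := ‖a - b‖ with hy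
  have h1 := Real.pow_div_factorial_le_exp (y ^ 2 / (4 * τ)) (by positivity) 6
  have hf : ((Nat.factorial 6 : ℕ) : ℝ) = 720 := by norm_num [Nat.factorial]
  rw [hf] at h1
  have h2 : y ^ 12 ≤ 720 * (4 * τ) ^ 6 * rexp (y ^ 2 / (4 * τ)) := by
    rw [div_le_iff₀ (by norm_num), div_pow, div_le_iff₀ (by positivity)] at h1
    calc y ^ 12 = (y ^ 2) ^ 6 := by ring
      _ ≤ _ := h1
      _ = _ := by ring
  have h3 : (2 * π * (2 * τ)) ^ (-((3:ℕ):ℝ)/2) =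
      (2:ℝ) ^ (-((3:ℕ):ℝ)/2) * (2 * π * τ) ^ (-((3:ℕ):ℝ)/2) := by
    rw [← Real.mul_rpow (by norm_num) (by positivity)]; congr 1; ring
  have h4 : (1:ℝ) ≤ 4 * (2:ℝ) ^ (-((3:ℕ):ℝ)/2) := by
    have : (2:ℝ) ^ (-(2:ℝ)) ≤ (2:ℝ) ^ (-((3:ℕ):ℝ)/2) :=
      Real.rpow_le_rpow_of_exponent_le (by norm_num) (by norm_num)
    have h5 : (2:ℝ) ^ (-(2:ℝ)) = 1 / 4 := by
      rw [Real.rpow_neg (by norm_num)]; norm_num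
    linarith
  have h5 : rexp (-y ^ 2 / (2 * (2 * τ))) = rexp (y ^ 2 / (4 * τ)) * rexp (-y ^ 2 / (2 * τ)) := by
    rw [← Real.exp_add]; congr 1; field_simp; ring
  rw [h3, h5]
  set c := (2 * π * τ) ^ (-((3:ℕ):ℝ)/2)
  set c2 := (2:ℝ) ^ (-((3:ℕ):ℝ)/2)
  set e1 := rexp (y ^ 2 / (4 * τ))
  set e2 := rexp (-y ^ 2 / (2 * τ))
  have hc : 0 ≤ c := by positivity
  have he2 : 0 ≤ e2 := by positivity
  have he1 : 0 ≤ e1 := by positivity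
  calc y ^ 12 * (c * e2) ≤ 720 * (4 * τ) ^ 6 * e1 * (c * e2) := by gcongr
    _ = 720 * (4 * τ) ^ 6 * e1 * (c * e2) * 1 := by ring
    _ ≤ 720 * (4 * τ) ^ 6 * e1 * (c * e2) * (4 * c2) := by gcongr
    _ = _ := by unfold momC; ring

lemma heatKernel_le {τ : ℝ} (hτ : 1 / 4 ≤ τ) (a b : E3) :
    (2 * π * 1) ^ (((3:ℕ):ℝ)/2) * heatKernel 3 τ a b ≤ 8 := by
  unfold heatKernel
  have h1 : rexp (-‖a - b‖ ^ 2 / (2 * τ)) ≤ 1 := by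
    rw [Real.exp_le_one_iff]
    apply div_nonpos_of_nonpos_of_nonneg
    · simp
    · linarith
  have h2 : (2 * π * τ) ^ (-((3:ℕ):ℝ)/2) ≤ (2 * π * (1 / 4)) ^ (-((3:ℕ):ℝ)/2) := by
    apply Real.rpow_le_rpow_of_nonpos (by positivity) (by gcongr) (by norm_num)
  have h3 : (2 * π * 1) ^ (((3:ℕ):ℝ)/2) * (2 * π * (1 / 4)) ^ (-((3:ℕ):ℝ)/2) = 8 := by
    rw [neg_div, Real.rpow_neg (by positivity), ← div_eq_mul_inv,
      ← Real.div_rpow (by positivity) (by positivity)]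
    have : 2 * π * 1 / (2 * π * (1 / 4)) = 2 ^ (2:ℝ) := by
      have := Real.pi_pos
      norm_num
      field_simp
    rw [this, ← Real.rpow_mul (by norm_num)]
    norm_num
  calc _ ≤ (2 * π * 1) ^ (((3:ℕ):ℝ)/2) * ((2 * π * (1 / 4)) ^ (-((3:ℕ):ℝ)/2) * 1) := by gcongr
    _ = 8 := by rw [mul_one ((2 * π * (1 / 4)) ^ (-((3:ℕ):ℝ)/2)), h3]

lemma lintegral_two_moment {σ τ : ℝ} (hσ : 0 < σ) (hτ : 0 < τ) :
    ∫⁻ p : E3 × E3, ENNReal.ofReal (8 * momC * τ ^ 6) *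
      (ENNReal.ofReal (heatKernel 3 σ p.1 0) * ENNReal.ofReal (heatKernel 3 (2 * τ) p.2 p.1)) =
      ENNReal.ofReal (8 * momC * τ ^ 6) := by
  have hm1 : Measurable (fun p : E3 × E3 => ENNReal.ofReal (heatKernel 3 (2 * τ) p.2 p.1)) :=
    ((measurable_heatKernel (2 * τ)).comp measurable_swap).ennreal_ofReal
  have hm2 : Measurable (fun p : E3 => ENNReal.ofReal (heatKernel 3 σ p 0)) :=
    measurable_heatKernel_left _ _
  have hm3 : Measurable (fun p : E3 × E3 =>
      ENNReal.ofReal (heatKernel 3 σ p.1 0) * ENNReal.ofReal (heatKernel 3 (2 * τ) p.2 p.1)) :=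
    (hm2.comp measurable_fst).mul hm1
  rw [lintegral_const_mul _ hm3, Measure.volume_eq_prod, lintegral_prod _ hm3.aemeasurable]
  have : ∀ a : E3, ∫⁻ b : E3, ENNReal.ofReal (heatKernel 3 σ a 0) *
      ENNReal.ofReal (heatKernel 3 (2 * τ) b a) = ENNReal.ofReal (heatKernel 3 σ a 0) := by
    intro a
    have hm4 : Measurable (fun b : E3 => ENNReal.ofReal (heatKernel 3 (2 * τ) b a)) :=
      measurable_heatKernel_left _ _
    rw [lintegral_const_mul _ hm4]
    rw [lintegral_heatKernel (by positivity), mul_one]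
  simp only [this]
  rw [lintegral_heatKernel hσ, mul_one]

lemma bridge_moment_interior {Q : Measure C(ℝ, E3)} (hQ : IsBrownianBridge 3 0 1 Q) {u v : ℝ}
    (hu : 0 < u) (huv : u < v) (hv : v < 1) (h2 : v - u ≤ 1 / 2) :
    ∫⁻ w, ENNReal.ofReal (‖w v - w u‖ ^ 12) ∂Q ≤ ENNReal.ofReal (8 * momC * (v - u) ^ 6) := by
  have hτ : 0 < v - u := by linarith
  have hfdd := hQ.2.2 2 ![u, v] (by
    intro i j hij
    fin_cases i <;> fin_cases j <;> simp_all) (by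
    intro j
    fin_cases j
    · exact ⟨hu, by simpa using huv.trans hv⟩
    · exact ⟨by simpa using hu.trans huv, by simpa using hv⟩)
  have hF : Measurable (fun z : Fin 2 → E3 => ENNReal.ofReal (‖z 1 - z 0‖ ^ 12)) := by fun_prop
  have e1 : ∫⁻ w, ENNReal.ofReal (‖w v - w u‖ ^ 12) ∂Q =
      ∫⁻ z : Fin 2 → E3, ENNReal.ofReal (‖z 1 - z 0‖ ^ 12)
        ∂(Q.map (fun w => fun j => w ((![u, v] : Fin 2 → ℝ) j))) := by
    rw [lintegral_map hF (measurable_pi_lambda _ fun j => measurable_path_eval _)]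
    simp
  set D : E3 × E3 → ENNReal := fun p => ENNReal.ofReal ((2 * π * 1) ^ (((3:ℕ):ℝ)/2) *
    (heatKernel 3 u 0 p.1 * heatKernel 3 (v - u) p.1 p.2 * heatKernel 3 (1 - v) p.2 0)) with hD
  have hDm : Measurable D := by
    apply ENNReal.measurable_ofReal.comp
    apply Continuous.measurable
    unfold heatKernel
    fun_prop
  have hdens : (fun z : Fin 2 → E3 =>
            let tt : Fin (2+2) → ℝ := Fin.snoc (Fin.cons 0 ![u, v]) 1
            let zz : Fin (2+2) → E3 := Fin.snoc (Fin.cons 0 z) 0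
            ENNReal.ofReal ((2 * π * 1) ^ (((3:ℕ):ℝ)/2) *
              ∏ j : Fin (2+1), heatKernel 3 (tt j.succ - tt j.castSucc)
                (zz j.castSucc) (zz j.succ))) = fun z => D (z 0, z 1) := by
    funext z
    simp only [hD]
    congr 2
    rw [Fin.prod_univ_three]
    have : heatKernel 3 u 0 (z 0) = heatKernel 3 (u - 0) 0 (z 0) := by rw [sub_zero]
    rw [this]
    rfl
  rw [e1, hfdd, hdens, ← volume_pi, lintegral_withDensity_eq_lintegral_mul _ (by fun_prop) hF]
  have e2 := (volume_preserving_finTwoArrow E3).lintegral_comp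
    (f := fun p : E3 × E3 => D p * ENNReal.ofReal (‖p.2 - p.1‖ ^ 12))
    (by fun_prop)
  have e3 : ∫⁻ z : Fin 2 → E3, ((fun z : Fin 2 → E3 => D (z 0, z 1)) *
      fun z : Fin 2 → E3 => ENNReal.ofReal (‖z 1 - z 0‖ ^ 12)) z =
      ∫⁻ p : E3 × E3, D p * ENNReal.ofReal (‖p.2 - p.1‖ ^ 12) := by
    rw [← e2]; rfl
  rw [e3]
  rcases le_total (1 / 4) u with h | h
  · rw [← lintegral_two_moment (show (0:ℝ) < 1 - v by linarith) hτ]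
    have hsw : ∀ F : E3 × E3 → ENNReal, ∫⁻ p : E3 × E3, F p.swap = ∫⁻ p, F p := by
      intro F
      rw [Measure.volume_eq_prod, lintegral_prod_swap]
    rw [← hsw]
    refine lintegral_mono fun p => ?_
    simp only [hD, Prod.fst_swap, Prod.snd_swap]
    have k1 := heatKernel_le h (0 : E3) p.2
    have k2 := heatKernel_moment hτ p.2 p.1
    have n1 := heatKernel_nonneg hu (0 : E3) p.2
    have n2 := heatKernel_nonneg hτ p.2 p.1
    have n3 := heatKernel_nonneg (show (0:ℝ) < 1 - v by linarith) p.1 (0 : E3)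
    have n4 := heatKernel_nonneg (show (0:ℝ) < 2 * (v - u) by linarith) p.2 p.1
    have n5 := momC_pos
    rw [← ENNReal.ofReal_mul' (by positivity), ← ENNReal.ofReal_mul n3,
      ← ENNReal.ofReal_mul (by positivity)]
    apply ENNReal.ofReal_le_ofReal
    calc _ = ((2 * π * 1) ^ (((3:ℕ):ℝ)/2) * heatKernel 3 u 0 p.2) *
          (‖p.1 - p.2‖ ^ 12 * heatKernel 3 (v - u) p.2 p.1) * heatKernel 3 (1 - v) p.1 0 := by ring
      _ ≤ 8 * (momC * (v - u) ^ 6 * heatKernel 3 (2 * (v - u)) p.2 p.1) *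
          heatKernel 3 (1 - v) p.1 0 := by gcongr
      _ = _ := by ring
  · rw [← lintegral_two_moment hu hτ]
    refine lintegral_mono fun p => ?_
    simp only [hD]
    have k1 := heatKernel_le (show 1 / 4 ≤ 1 - v by linarith) p.2 (0 : E3)
    have k2 := heatKernel_moment hτ p.1 p.2
    have n1 := heatKernel_nonneg hu p.1 (0 : E3)
    have n2 := heatKernel_nonneg hτ p.1 p.2
    have n3 := heatKernel_nonneg (show (0:ℝ) < 1 - v by linarith) p.2 (0 : E3)
    have n4 := heatKernel_nonneg (show (0:ℝ) < 2 * (v - u) by linarith) p.2 p.1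
    have n5 := momC_pos
    rw [← ENNReal.ofReal_mul' (by positivity), ← ENNReal.ofReal_mul n1,
      ← ENNReal.ofReal_mul (by positivity)]
    apply ENNReal.ofReal_le_ofReal
    rw [heatKernel_symm u, heatKernel_symm (2 * (v - u)) p.2]
    rw [heatKernel_symm (2 * (v - u)) p.2] at n4
    calc _ = ((2 * π * 1) ^ (((3:ℕ):ℝ)/2) * heatKernel 3 (1 - v) p.2 0) *
          (‖p.2 - p.1‖ ^ 12 * heatKernel 3 (v - u) p.1 p.2) * heatKernel 3 u p.1 0 := by ring
      _ ≤ 8 * (momC * (v - u) ^ 6 * heatKernel 3 (2 * (v - u)) p.1 p.2) *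
          heatKernel 3 u p.1 0 := by gcongr
      _ = _ := by ring

lemma bridge_moment {Q : Measure C(ℝ, E3)} (hQ : IsBrownianBridge 3 0 1 Q) {u v : ℝ}
    (hu : 0 ≤ u) (huv : u < v) (hv : v ≤ 1) (h2 : v - u ≤ 1 / 2) :
    ∫⁻ w, ENNReal.ofReal (‖w v - w u‖ ^ 12) ∂Q ≤ ENNReal.ofReal (8 * momC * (v - u) ^ 6) := by
  have hτ : 0 < v - u := by linarith
  set ε : ℕ → ℝ := fun n => (v - u) / ((n:ℝ) + 3) with hε
  have hεp : ∀ n, 0 < ε n := fun n => by positivity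
  have hεl : ∀ n, ε n ≤ (v - u) / 3 := fun n => by
    simp only [hε]
    gcongr
    linarith [(Nat.cast_nonneg n : (0:ℝ) ≤ n)]
  have hε0 : Filter.Tendsto ε Filter.atTop (nhds 0) := by
    apply Filter.Tendsto.div_atTop tendsto_const_nhds
    exact Filter.tendsto_atTop_add_const_right _ _ tendsto_natCast_atTop_atTop
  have hlim : ∀ w : C(ℝ, E3), Filter.Tendsto
      (fun n => ENNReal.ofReal (‖w (v - ε n) - w (u + ε n)‖ ^ 12)) Filter.atTop
      (nhds (ENNReal.ofReal (‖w v - w u‖ ^ 12))) := by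
    intro w
    have hc : Continuous (fun e : ℝ => ENNReal.ofReal (‖w (v - e) - w (u + e)‖ ^ 12)) :=
      ENNReal.continuous_ofReal.comp (by fun_prop)
    have := (hc.tendsto 0).comp hε0
    simpa [Function.comp_def] using this
  calc ∫⁻ w, ENNReal.ofReal (‖w v - w u‖ ^ 12) ∂Q
      = ∫⁻ w, Filter.liminf (fun n => ENNReal.ofReal (‖w (v - ε n) - w (u + ε n)‖ ^ 12))
          Filter.atTop ∂Q := by
        refine lintegral_congr fun w => ?_
        exact (hlim w).liminf_eq.symm
    _ ≤ Filter.liminf (fun n => ∫⁻ w, ENNReal.ofReal (‖w (v - ε n) - w (u + ε n)‖ ^ 12) ∂Q)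
          Filter.atTop := by
        apply lintegral_liminf_le
        intro n
        have h1 := measurable_path_eval (v - ε n)
        have h2 := measurable_path_eval (u + ε n)
        fun_prop
    _ ≤ _ := by
        have hb : ∀ n, ∫⁻ w, ENNReal.ofReal (‖w (v - ε n) - w (u + ε n)‖ ^ 12) ∂Q ≤
            ENNReal.ofReal (8 * momC * (v - u) ^ 6) := by
          intro n
          have a1 := hεp n
          have a2 := hεl n
          refine (bridge_moment_interior hQ (u := u + ε n) (v := v - ε n) (by linarith)
            (by linarith) (by linarith) (by linarith)).trans ?_
          apply ENNReal.ofReal_le_ofReal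
          have := momC_pos
          have b1 : 0 ≤ v - ε n - (u + ε n) := by linarith
          gcongr <;> linarith
        refine (Filter.liminf_le_liminf (Filter.Eventually.of_forall hb)).trans ?_
        simp

/-- normalized dyadic increment to the power twelve -/
noncomputable def incrTerm (w : C(ℝ, E3)) (m j : ℕ) : ENNReal :=
  ENNReal.ofReal ((‖w (((j:ℝ) + 1) / 2 ^ m) - w ((j:ℝ) / 2 ^ m)‖ / (3 / 4) ^ m) ^ 12)

/-- the chaining functional -/
noncomputable def chainS (w : C(ℝ, E3)) : ENNReal :=
  ∑' n : ℕ, ∑ j ∈ Finset.range (2 ^ (n + 1)), incrTerm w (n + 1) j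

lemma measurable_incrTerm (m j : ℕ) : Measurable (fun w => incrTerm w m j) := by
  unfold incrTerm
  have h1 := measurable_path_eval (((j:ℝ) + 1) / 2 ^ m)
  have h2 := measurable_path_eval ((j:ℝ) / 2 ^ m)
  fun_prop

lemma measurable_chainS : Measurable chainS := by
  unfold chainS
  refine Measurable.tsum fun n => ?_
  exact Finset.measurable_sum _ fun j _ => measurable_incrTerm _ _

lemma lintegral_incrTerm {Q : Measure C(ℝ, E3)} (hQ : IsBrownianBridge 3 0 1 Q) (n j : ℕ)
    (hj : j < 2 ^ (n + 1)) :
    ∫⁻ w, incrTerm w (n + 1) j ∂Q ≤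
      ENNReal.ofReal (8 * momC * (1 / 64 * (4 / 3) ^ 12) ^ (n + 1)) := by
  have hp : (0:ℝ) < 2 ^ (n + 1) := by positivity
  have hd : ((j:ℝ) + 1) / 2 ^ (n + 1) - (j:ℝ) / 2 ^ (n + 1) = 1 / 2 ^ (n + 1) := by ring
  have hj' : (j:ℝ) + 1 ≤ 2 ^ (n + 1) := by exact_mod_cast hj
  have h1 := bridge_moment hQ (u := (j:ℝ) / 2 ^ (n + 1)) (v := ((j:ℝ) + 1) / 2 ^ (n + 1))
    (by positivity) (by gcongr; linarith) ((div_le_one hp).2 hj') (by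
      rw [hd, one_div, one_div]
      apply inv_anti₀ (by norm_num)
      rw [pow_succ]
      have : (1:ℝ) ≤ 2 ^ n := one_le_pow₀ (by norm_num)
      linarith)
  rw [hd] at h1
  have h2 : ∀ w : C(ℝ, E3), incrTerm w (n + 1) j =
      ENNReal.ofReal (((3 / 4) ^ (n + 1)) ^ 12)⁻¹ *
      ENNReal.ofReal (‖w (((j:ℝ) + 1) / 2 ^ (n + 1)) - w ((j:ℝ) / 2 ^ (n + 1))‖ ^ 12) := by
    intro w
    unfold incrTerm
    rw [← ENNReal.ofReal_mul (by positivity)]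
    congr 1
    rw [div_pow]; ring
  have hm : Measurable (fun w : C(ℝ, E3) =>
      ENNReal.ofReal (‖w (((j:ℝ) + 1) / 2 ^ (n + 1)) - w ((j:ℝ) / 2 ^ (n + 1))‖ ^ 12)) := by
    have h1 := measurable_path_eval (((j:ℝ) + 1) / 2 ^ (n + 1))
    have h2 := measurable_path_eval ((j:ℝ) / 2 ^ (n + 1))
    fun_prop
  simp_rw [h2]
  rw [lintegral_const_mul _ hm]
  refine (mul_le_mul_right h1 _).trans ?_
  rw [← ENNReal.ofReal_mul (by positivity)]
  apply le_of_eq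
  congr 1
  have e1 : ((3 / 4 : ℝ) ^ (n + 1)) ^ 12 = ((3 / 4) ^ 12) ^ (n + 1) := by
    rw [← pow_mul, ← pow_mul, mul_comm]
  have e2 : (1 / 2 ^ (n + 1) : ℝ) ^ 6 = (1 / 64) ^ (n + 1) := by
    rw [← one_div_pow, ← pow_mul, mul_comm, pow_mul]; norm_num
  rw [e1, e2, ← inv_pow, mul_pow]
  have e3 : (((3 / 4 : ℝ) ^ 12)⁻¹) = (4 / 3) ^ 12 := by norm_num
  rw [e3]; ring

lemma lintegral_chainS {Q : Measure C(ℝ, E3)} (hQ : IsBrownianBridge 3 0 1 Q) :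
    ∫⁻ w, chainS w ∂Q ≠ ⊤ := by
  unfold chainS
  rw [lintegral_tsum (fun n => (Finset.measurable_sum _
    fun j _ => measurable_incrTerm _ _).aemeasurable)]
  have hb : ∀ n : ℕ, ∫⁻ w, ∑ j ∈ Finset.range (2 ^ (n + 1)), incrTerm w (n + 1) j ∂Q ≤
      ENNReal.ofReal (8 * momC * (1 / 32 * (4 / 3) ^ 12) ^ (n + 1)) := by
    intro n
    rw [lintegral_finsetSum _ fun j _ => measurable_incrTerm _ _]
    refine (Finset.sum_le_sum fun j hj => lintegral_incrTerm hQ n j (Finset.mem_range.1 hj)).trans ?_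
    rw [Finset.sum_const, Finset.card_range, nsmul_eq_mul, ← ENNReal.ofReal_natCast,
      ← ENNReal.ofReal_mul (by positivity)]
    apply le_of_eq
    congr 1
    push_cast
    rw [show (1 / 32 * (4 / 3) ^ 12 : ℝ) = 2 * (1 / 64 * (4 / 3) ^ 12) by norm_num, mul_pow 2]
    ring
  refine ne_top_of_le_ne_top ?_ (ENNReal.tsum_le_tsum hb)
  have hs : Summable (fun n : ℕ => 8 * momC * (1 / 32 * (4 / 3 : ℝ) ^ 12) ^ (n + 1)) := by
    apply Summable.mul_left
    exact (summable_nat_add_iff 1).2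
      (summable_geometric_of_lt_one (by norm_num) (by norm_num))
  rw [← ENNReal.ofReal_tsum_of_nonneg _ hs]
  · exact ENNReal.ofReal_ne_top
  · intro n
    have := momC_pos
    positivity

/-- the Hölder-type constant of a path -/
noncomputable def chainK (w : C(ℝ, E3)) : ℝ := (chainS w).toReal ^ ((1:ℝ) / 12)

lemma chainK_nonneg (w : C(ℝ, E3)) : 0 ≤ chainK w := by unfold chainK; positivity

lemma chainK_pow (w : C(ℝ, E3)) : chainK w ^ 12 = (chainS w).toReal := by
  unfold chainK
  rw [← Real.rpow_natCast, ← Real.rpow_mul ENNReal.toReal_nonneg]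
  norm_num

lemma incr_le (w : C(ℝ, E3)) (hw : chainS w ≠ ⊤) (n j : ℕ) (hj : j < 2 ^ (n + 1)) :
    ‖w (((j:ℝ) + 1) / 2 ^ (n + 1)) - w ((j:ℝ) / 2 ^ (n + 1))‖ ≤ chainK w * (3 / 4) ^ (n + 1) := by
  have h1 : incrTerm w (n + 1) j ≤ chainS w := by
    refine le_trans ?_ (ENNReal.le_tsum n)
    exact Finset.single_le_sum (f := fun j => incrTerm w (n + 1) j) (fun _ _ => zero_le)
      (Finset.mem_range.2 hj)
  unfold incrTerm at h1
  rw [ENNReal.ofReal_le_iff_le_toReal hw, ← chainK_pow] at h1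
  have h2 := le_of_pow_le_pow_left₀ (by norm_num) (chainK_nonneg w) h1
  rwa [div_le_iff₀ (by positivity)] at h2

lemma chaining (w : C(ℝ, E3)) (hw : chainS w ≠ ⊤) (s : ℝ) (hs0 : 0 ≤ s) (hs1 : s < 1) (n : ℕ) :
    ‖w ((⌊s * 2 ^ n⌋₊ : ℝ) / 2 ^ n) - w s‖ ≤ 3 * chainK w * (3 / 4) ^ n := by
  set f : ℕ → E3 := fun m => w ((⌊s * 2 ^ m⌋₊ : ℝ) / 2 ^ m) with hf
  have hstep : ∀ m, dist (f m) (f (m + 1)) ≤ chainK w * (3 / 4) * (3 / 4) ^ m := by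
    intro m
    have hp : (0:ℝ) < 2 ^ m := by positivity
    have hx : 0 ≤ s * 2 ^ m := by positivity
    have hx' : 0 ≤ s * 2 ^ (m + 1) := by positivity
    set a := ⌊s * 2 ^ m⌋₊ with ha
    set b := ⌊s * 2 ^ (m + 1)⌋₊ with hb
    have a1 := Nat.floor_le hx
    have a2 := Nat.lt_floor_add_one (s * 2 ^ m)
    have hb1 : 2 * a ≤ b := by
      apply Nat.le_floor
      push_cast
      rw [pow_succ]; linarith
    have hb2 : b < 2 * a + 2 := by
      rw [hb, Nat.floor_lt hx']
      push_cast
      rw [pow_succ]; linarith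
    have hb3 : b < 2 ^ (m + 1) := by
      rw [hb, Nat.floor_lt hx']
      push_cast
      have : (0:ℝ) < 2 ^ (m + 1) := by positivity
      nlinarith
    have hK := chainK_nonneg w
    have hfm : f m = w (((2 * a : ℕ) : ℝ) / 2 ^ (m + 1)) := by
      simp only [hf]
      congr 1
      push_cast
      rw [← ha, pow_succ]; field_simp
    have hfm1 : f (m + 1) = w ((b : ℝ) / 2 ^ (m + 1)) := rfl
    rcases (by omega : b = 2 * a ∨ b = 2 * a + 1) with h | h
    · rw [hfm, hfm1, h, dist_self]; positivity
    · rw [hfm, hfm1, dist_comm, dist_eq_norm, h]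
      have := incr_le w hw m (2 * a) (by omega)
      push_cast at this ⊢
      refine this.trans (le_of_eq ?_)
      rw [pow_succ]; ring
  have hlim : Filter.Tendsto f Filter.atTop (nhds (w s)) := by
    have h1 : Filter.Tendsto (fun m : ℕ => (2:ℝ) ^ m) Filter.atTop Filter.atTop :=
      tendsto_pow_atTop_atTop_of_one_lt (by norm_num)
    have h2 := (tendsto_nat_floor_mul_div_atTop hs0).comp h1
    exact (w.continuous.tendsto s).comp h2
  have := dist_le_of_le_geometric_of_tendsto (3 / 4) (chainK w * (3 / 4)) (by norm_num) hstep
    hlim n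
  rw [dist_eq_norm] at this
  refine this.trans (le_of_eq ?_)
  ring

/-- paths which move by more than one half and come close to the sphere, seen at rational times -/
def goodSet (R : ℝ) : Set (ℝ → E3) :=
  {f | (∃ s u : ℚ, 1 / 2 < dist (f s) (f u)) ∧ ∃ s : ℚ, |‖f s‖ - R| < 1}

/-- volume of the unit ball -/
noncomputable def kap : ENNReal := volume (Metric.ball (0 : E3) 1)

lemma kap_ne_top : kap ≠ ⊤ := measure_ball_lt_top.ne

lemma kap_mono {a b : ℝ} (h : a ≤ b) : ENNReal.ofReal a * kap ≤ ENNReal.ofReal b * kap := by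
  have := ENNReal.ofReal_le_ofReal h
  gcongr

lemma kap_assoc {a b : ℝ} (h : 0 ≤ a) :
    ENNReal.ofReal a * (ENNReal.ofReal b * kap) = ENNReal.ofReal (a * b) * kap := by
  rw [ENNReal.ofReal_mul h, mul_assoc]

lemma vol_closedBall {r : ℝ} (hr : 0 ≤ r) :
    volume (Metric.closedBall (0 : E3) r) = ENNReal.ofReal (r ^ 3) * kap := by
  have := Measure.addHaar_closedBall (volume : Measure E3) 0 hr
  simpa [kap] using this

lemma vol_ball {r : ℝ} (hr : 0 ≤ r) :
    volume (Metric.ball (0 : E3) r) = ENNReal.ofReal (r ^ 3) * kap := by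
  have := Measure.addHaar_ball (volume : Measure E3) 0 hr
  simpa [kap] using this

lemma shell_vol_one {R δ : ℝ} (hR : 0 ≤ R) (hδ : 0 ≤ δ) :
    volume {y : E3 | |‖y‖ - R| ≤ δ} ≤ ENNReal.ofReal ((R + δ) ^ 3) * kap := by
  rw [← vol_closedBall (by positivity)]
  apply measure_mono
  intro y hy
  have hy' : |‖y‖ - R| ≤ δ := hy
  have := (abs_le.1 hy').2
  simp only [mem_closedBall_zero_iff]
  linarith

lemma shell_vol_two {R δ : ℝ} (hR : 0 ≤ R) (hδ : 0 ≤ δ) :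
    volume {y : E3 | |‖y‖ - R| ≤ δ} ≤ ENNReal.ofReal (6 * R ^ 2 * δ + 8 * δ ^ 3) * kap := by
  rcases le_total R δ with h | h
  · refine (shell_vol_one hR hδ).trans ?_
    gcongr
    have : (R + δ) ^ 3 ≤ (δ + δ) ^ 3 := by gcongr
    have : 0 ≤ R ^ 2 * δ := by positivity
    nlinarith
  · have hsub : {y : E3 | |‖y‖ - R| ≤ δ} ⊆
        Metric.closedBall (0 : E3) (R + δ) \ Metric.ball (0 : E3) (R - δ) := by
      intro y hy
      have hy' : |‖y‖ - R| ≤ δ := hy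
      have := abs_le.1 hy'
      simp only [Set.mem_sdiff, mem_closedBall_zero_iff, mem_ball_zero_iff]
      constructor <;> linarith
    refine (measure_mono hsub).trans ?_
    rw [measure_sdiff, vol_closedBall (by positivity), vol_ball (by linarith),
      ← ENNReal.sub_mul (fun _ _ => kap_ne_top),
      ← ENNReal.ofReal_sub _ (pow_nonneg (by linarith) 3)]
    · gcongr
      have : 0 ≤ δ ^ 3 := by positivity
      nlinarith
    · intro y hy
      simp only [mem_closedBall_zero_iff, mem_ball_zero_iff] at hy ⊢
      linarith
    · exact measurableSet_ball.nullMeasurableSet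
    · exact measure_ball_lt_top.ne

section det

variable (w : C(ℝ, E3))

lemma near_dyadic (hw : chainS w ≠ ⊤) (hw0 : ∀ s : ℝ, s ∉ Set.Ioo 0 1 → w s = 0)
    (s : ℝ) (n : ℕ) : ∃ j ∈ Finset.range (2 ^ n),
    ‖w ((j : ℝ) / 2 ^ n) - w s‖ ≤ 3 * chainK w * (3 / 4) ^ n := by
  have hK := chainK_nonneg w
  by_cases hs : s ∈ Set.Ioo (0:ℝ) 1
  · refine ⟨⌊s * 2 ^ n⌋₊, ?_, chaining w hw s hs.1.le hs.2 n⟩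
    rw [Finset.mem_range, Nat.floor_lt (by have := hs.1; positivity)]
    push_cast
    have : (0:ℝ) < 2 ^ n := by positivity
    nlinarith [hs.2]
  · refine ⟨0, by simp, ?_⟩
    rw [hw0 s hs]
    have : w 0 = 0 := hw0 0 (by simp)
    simp only [Nat.cast_zero, zero_div, this, sub_zero, norm_zero]
    positivity

lemma path_norm_le (hw : chainS w ≠ ⊤) (hw0 : ∀ s : ℝ, s ∉ Set.Ioo 0 1 → w s = 0)
    (s : ℝ) : ‖w s‖ ≤ 3 * chainK w := by
  obtain ⟨j, hj, h⟩ := near_dyadic w hw hw0 s 0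
  have h0 : w 0 = 0 := hw0 0 (by simp)
  simp at hj
  simpa [hj, h0] using h

/-- the set of starting points for which the scaled loop is good -/
def goodX (R t : ℝ) (w : C(ℝ, E3)) : Set E3 := {x | (fun s => scalePath x t w s) ∈ goodSet R}

lemma goodX_subset (hw : chainS w ≠ ⊤) (hw0 : ∀ s : ℝ, s ∉ Set.Ioo 0 1 → w s = 0)
    (R t : ℝ) (n : ℕ) :
    goodX R t w ⊆ ⋃ j ∈ Finset.range (2 ^ n),
      (fun x => x + √t • w ((j : ℝ) / 2 ^ n)) ⁻¹'
        {y : E3 | |‖y‖ - R| ≤ 1 + √t * (3 * chainK w * (3 / 4) ^ n)} := by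
  rintro x ⟨-, s, hs⟩
  obtain ⟨j, hj, h⟩ := near_dyadic w hw hw0 (s / t) n
  simp only [Set.mem_iUnion]
  refine ⟨j, hj, ?_⟩
  simp only [Set.mem_preimage, Set.mem_ofPred_eq]
  simp only [scalePath_apply] at hs
  set y := w ((s:ℝ) / t)
  set z := w ((j : ℝ) / 2 ^ n)
  have h1 : |‖x + √t • z‖ - ‖x + √t • y‖| ≤ ‖√t • (z - y)‖ := by
    refine (abs_norm_sub_norm_le _ _).trans (le_of_eq ?_)
    congr 1
    rw [smul_sub]; abel
  rw [norm_smul, Real.norm_of_nonneg (Real.sqrt_nonneg t)] at h1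
  have h2 : √t * ‖z - y‖ ≤ √t * (3 * chainK w * (3 / 4) ^ n) := by gcongr
  have h3 : |‖x + √t • z‖ - R| ≤ |‖x + √t • z‖ - ‖x + √t • y‖| + |‖x + √t • y‖ - R| :=
    abs_sub_le _ _ _
  linarith

lemma goodX_vol (hw : chainS w ≠ ⊤) (hw0 : ∀ s : ℝ, s ∉ Set.Ioo 0 1 → w s = 0)
    (R t : ℝ) (n : ℕ) :
    volume (goodX R t w) ≤ 2 ^ n *
      volume {y : E3 | |‖y‖ - R| ≤ 1 + √t * (3 * chainK w * (3 / 4) ^ n)} := by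
  refine (measure_mono (goodX_subset w hw hw0 R t n)).trans ?_
  refine (measure_biUnion_finset_le _ _).trans ?_
  simp only [measure_preimage_add_right, Finset.sum_const, Finset.card_range, nsmul_eq_mul]
  push_cast
  exact le_rfl

lemma goodX_empty (hw : chainS w ≠ ⊤) (hw0 : ∀ s : ℝ, s ∉ Set.Ioo 0 1 → w s = 0)
    (R t : ℝ) (h : 4 * (√t * (3 * chainK w)) ≤ 1) : goodX R t w = ∅ := by
  rw [Set.eq_empty_iff_forall_notMem]
  rintro x ⟨⟨s, u, hsu⟩, -⟩
  simp only [scalePath_apply, dist_add_left] at hsu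
  rw [dist_eq_norm, ← smul_sub, norm_smul, Real.norm_of_nonneg (Real.sqrt_nonneg t)] at hsu
  have h1 := path_norm_le w hw hw0 (s / t)
  have h2 := path_norm_le w hw hw0 (u / t)
  have h3 := norm_sub_le (w (s / t)) (w (u / t))
  have h4 : √t * ‖w (s / t) - w (u / t)‖ ≤ √t * (3 * chainK w + 3 * chainK w) := by
    gcongr; linarith
  linarith

/-- the weight of the loop measure -/
noncomputable def wt (t : ℝ) : ℝ := t⁻¹ * (2 * π * t) ^ (-(3:ℝ)/2)

lemma wt_le {t : ℝ} (ht : 0 < t) : wt t ≤ t⁻¹ * (t * √t)⁻¹ := by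
  unfold wt
  have h1 : (2 * π * t) ^ (-(3:ℝ)/2) ≤ t ^ (-(3:ℝ)/2) := by
    apply Real.rpow_le_rpow_of_nonpos ht _ (by norm_num)
    have := Real.pi_gt_three
    nlinarith
  have h2 : t ^ (-(3:ℝ)/2) = (t * √t)⁻¹ := by
    rw [neg_div, Real.rpow_neg ht.le, show (3:ℝ)/2 = 1 + 1/2 by norm_num, Real.rpow_add ht,
      Real.rpow_one, Real.sqrt_eq_rpow]
  rw [← h2]
  gcongr

lemma lintegral_inv_sq {a : ℝ} (ha : 0 < a) :
    ∫⁻ t in Set.Ioi a, ENNReal.ofReal ((t ^ 2)⁻¹) = ENNReal.ofReal a⁻¹ := by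
  have h1 := integral_Ioi_rpow_of_lt (show (-2:ℝ) < -1 by norm_num) ha
  have h2 := integrableOn_Ioi_rpow_of_lt (show (-2:ℝ) < -1 by norm_num) ha
  have e : ∀ t ∈ Set.Ioi a, (t ^ 2)⁻¹ = t ^ (-2:ℝ) := by
    intro t ht
    have ht0 : 0 < t := ha.trans ht
    rw [Real.rpow_neg ht0.le]; norm_num
  rw [setLIntegral_congr_fun measurableSet_Ioi (fun t ht => by
      show ENNReal.ofReal _ = ENNReal.ofReal (t ^ (-2:ℝ)); rw [e t ht]),
    ← ofReal_integral_eq_lintegral_ofReal h2, h1]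
  · congr 1
    rw [show (-2:ℝ) + 1 = -1 by norm_num, Real.rpow_neg_one]
    ring
  · filter_upwards [ae_restrict_mem measurableSet_Ioi] with t ht
    exact Real.rpow_nonneg (ha.trans ht).le _

lemma small_part (hw : chainS w ≠ ⊤) (hw0 : ∀ s : ℝ, s ∉ Set.Ioo 0 1 → w s = 0)
    {R : ℝ} (hR : 1 ≤ R) :
    ∫⁻ t in Set.Ioo 0 (R ^ 2), ENNReal.ofReal (wt t) * volume (goodX R t w) ≤
      ENNReal.ofReal (16480 * R ^ 2 * (1 + 3 * chainK w) ^ 5) * kap := by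
  set L := 3 * chainK w with hL
  have hL0 : 0 ≤ L := by have := chainK_nonneg w; positivity
  rcases hL0.eq_or_lt with h0 | hLp
  · have : ∀ t, volume (goodX R t w) = 0 := by
      intro t
      rw [goodX_empty w hw hw0 R t (by rw [← hL, ← h0]; simp), measure_empty]
    simp [this]
  have ha : 0 < 1 / (16 * L ^ 2) := by positivity
  set B : ℝ := R ^ 2 * (30 * L + 1000 * L ^ 3) with hB
  have hB0 : 0 ≤ B := by positivity
  have hb : ∀ t ∈ Set.Ioo 0 (R ^ 2), ENNReal.ofReal (wt t) * volume (goodX R t w) ≤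
      (Set.Ioi (1 / (16 * L ^ 2))).indicator
        (fun t => ENNReal.ofReal ((t ^ 2)⁻¹) * (ENNReal.ofReal B * kap)) t := by
    intro t ht
    have ht0 := ht.1
    have hst : 0 < √t := Real.sqrt_pos.2 ht0
    have hsq : √t * √t = t := Real.mul_self_sqrt ht0.le
    by_cases h : 4 * (√t * L) ≤ 1
    · rw [goodX_empty w hw hw0 R t h]; simp
    · push Not at h
      have hmem : t ∈ Set.Ioi (1 / (16 * L ^ 2)) := by
        rw [Set.mem_Ioi, div_lt_iff₀ (by positivity)]
        calc (1:ℝ) < (4 * (√t * L)) * (4 * (√t * L)) := by nlinarith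
          _ = 16 * (√t * √t) * L ^ 2 := by ring
          _ = _ := by rw [hsq]; ring
      rw [Set.indicator_of_mem hmem]
      have hv := goodX_vol w hw hw0 R t 0
      rw [← hL] at hv
      simp only [pow_zero, one_mul, mul_one] at hv
      have hv2 := hv.trans (shell_vol_two (by linarith) (by positivity))
      set δ := 1 + √t * L with hδ
      have hδ0 : 0 ≤ δ := by positivity
      have hδ5 : δ ≤ 5 * (√t * L) := by linarith
      have hbd : 6 * R ^ 2 * δ + 8 * δ ^ 3 ≤ √t * B := by
        have h3 : δ ^ 3 ≤ (5 * (√t * L)) ^ 3 := by gcongr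
        have h4 : (5 * (√t * L)) ^ 3 ≤ 125 * R ^ 2 * √t * L ^ 3 := by
          calc (5 * (√t * L)) ^ 3 = 125 * (√t * √t) * √t * L ^ 3 := by ring
            _ = 125 * t * √t * L ^ 3 := by rw [hsq]
            _ ≤ _ := by have := ht.2.le; gcongr
        have h5 : 6 * R ^ 2 * δ ≤ 6 * R ^ 2 * (5 * (√t * L)) := by gcongr
        rw [hB]
        linarith
      calc ENNReal.ofReal (wt t) * volume (goodX R t w)
          ≤ ENNReal.ofReal (t⁻¹ * (t * √t)⁻¹) * (ENNReal.ofReal (√t * B) * kap) := by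
            gcongr
            · exact wt_le ht0
            · refine hv2.trans ?_
              gcongr
        _ = ENNReal.ofReal ((t ^ 2)⁻¹) * (ENNReal.ofReal B * kap) := by
            rw [kap_assoc (by positivity), kap_assoc (by positivity)]
            congr 2
            field_simp
  refine (setLIntegral_mono' measurableSet_Ioo hb).trans ?_
  refine (setLIntegral_le_lintegral _ _).trans ?_
  rw [lintegral_indicator measurableSet_Ioi, lintegral_mul_const' _ _
    (ENNReal.mul_ne_top ENNReal.ofReal_ne_top kap_ne_top), lintegral_inv_sq ha,
    kap_assoc (by positivity)]
  apply kap_mono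
  rw [one_div, inv_inv, hB]
  have h1 : L ^ 3 ≤ (1 + L) ^ 5 :=
    (pow_le_pow_left₀ hL0 (by linarith) 3).trans (pow_le_pow_right₀ (by linarith) (by norm_num))
  have h2 : L ^ 5 ≤ (1 + L) ^ 5 := pow_le_pow_left₀ hL0 (by linarith) 5
  calc 16 * L ^ 2 * (R ^ 2 * (30 * L + 1000 * L ^ 3))
      = R ^ 2 * (480 * L ^ 3 + 16000 * L ^ 5) := by ring
    _ ≤ R ^ 2 * (480 * (1 + L) ^ 5 + 16000 * (1 + L) ^ 5) := by gcongr
    _ = _ := by ring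

lemma large_piece (hw : chainS w ≠ ⊤) (hw0 : ∀ s : ℝ, s ∉ Set.Ioo 0 1 → w s = 0)
    {R : ℝ} (hR : 1 ≤ R) (n : ℕ) :
    ∫⁻ t in Set.Ico (R ^ 2 * 4 ^ n) (R ^ 2 * 4 ^ (n + 1)),
      ENNReal.ofReal (wt t) * volume (goodX R t w) ≤
      ENNReal.ofReal (24 * (1 + 3 * chainK w) ^ 3 * (729 / 1024) ^ n) * kap := by
  set L := 3 * chainK w with hL
  have hL0 : 0 ≤ L := by have := chainK_nonneg w; positivity
  have hR0 : 0 < R := by linarith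
  set D : ℝ := (R ^ 2 * 4 ^ n)⁻¹ * (R ^ 2 * 4 ^ n * (R * 2 ^ n))⁻¹ *
    (4 ^ n * (2 * R + 2 * R * 2 ^ n * (L * (9 / 16) ^ n)) ^ 3) with hD
  have hD0 : 0 ≤ D := by positivity
  have hb : ∀ t ∈ Set.Ico (R ^ 2 * 4 ^ n) (R ^ 2 * 4 ^ (n + 1)),
      ENNReal.ofReal (wt t) * volume (goodX R t w) ≤ ENNReal.ofReal D * kap := by
    intro t ht
    have hlow : 0 < R ^ 2 * 4 ^ n := by positivity
    have ht0 : 0 < t := hlow.trans_le ht.1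
    have e4 : ∀ m : ℕ, (4:ℝ) ^ m = (2 ^ m) ^ 2 := fun m => by
      rw [← pow_mul, mul_comm, pow_mul]; norm_num
    have hs1 : R * 2 ^ n ≤ √t := by
      apply Real.le_sqrt_of_sq_le
      rw [mul_pow, ← e4]; exact ht.1
    have hs2 : √t ≤ 2 * R * 2 ^ n := by
      rw [Real.sqrt_le_left (by positivity)]
      refine ht.2.le.trans (le_of_eq ?_)
      rw [mul_pow, mul_pow, ← e4]; ring
    have hv := goodX_vol w hw hw0 R t (2 * n)
    rw [← hL] at hv
    have e9 : (3 / 4 : ℝ) ^ (2 * n) = (9 / 16) ^ n := by rw [pow_mul]; norm_num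
    rw [e9] at hv
    have hv2 := hv.trans (mul_le_mul_right (shell_vol_one hR0.le (by positivity)) _)
    have e2 : (2:ENNReal) ^ (2 * n) = ENNReal.ofReal (4 ^ n) := by
      rw [ENNReal.ofReal_pow (by norm_num), pow_mul]; norm_num
    rw [e2, ← mul_assoc, ← ENNReal.ofReal_mul (by positivity)] at hv2
    calc ENNReal.ofReal (wt t) * volume (goodX R t w)
        ≤ ENNReal.ofReal ((R ^ 2 * 4 ^ n)⁻¹ * (R ^ 2 * 4 ^ n * (R * 2 ^ n))⁻¹) *
          (ENNReal.ofReal (4 ^ n * (2 * R + 2 * R * 2 ^ n * (L * (9 / 16) ^ n)) ^ 3) * kap) := by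
          gcongr
          · refine (wt_le ht0).trans ?_
            have := ht.1
            gcongr
          · refine hv2.trans ?_
            gcongr ENNReal.ofReal (4 ^ n * ?_ ^ 3) * kap
            have : √t * (L * (9 / 16) ^ n) ≤ 2 * R * 2 ^ n * (L * (9 / 16) ^ n) := by gcongr
            linarith
      _ = ENNReal.ofReal D * kap := by
          rw [kap_assoc (by positivity)]
  refine (setLIntegral_mono' measurableSet_Ico hb).trans ?_
  rw [setLIntegral_const, Real.volume_Ico, mul_right_comm, ← ENNReal.ofReal_mul hD0]
  apply kap_mono
  have key : 1 + L * (9 / 8) ^ n ≤ (9 / 8) ^ n * (1 + L) := by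
    have : (1:ℝ) ≤ (9 / 8) ^ n := one_le_pow₀ (by norm_num)
    nlinarith
  have e2 : (2:ℝ) ^ n * (9 / 16) ^ n = (9 / 8) ^ n := by rw [← mul_pow]; norm_num
  calc D * (R ^ 2 * 4 ^ (n + 1) - R ^ 2 * 4 ^ n)
      = 24 * (4 ^ n * (2 ^ n)⁻¹ * (4 ^ n)⁻¹) * (1 + L * (2 ^ n * (9 / 16) ^ n)) ^ 3 := by
        rw [hD, show (4:ℝ) ^ (n + 1) = 4 * 4 ^ n by ring]
        clear hb hD e2 hD0 D key
        generalize (9 / 16 : ℝ) ^ n = p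
        have h4 : (4:ℝ) ^ n ≠ 0 := by positivity
        have h2 : (2:ℝ) ^ n ≠ 0 := by positivity
        generalize (4:ℝ) ^ n = q at h4 ⊢
        generalize (2:ℝ) ^ n = r at h2 ⊢
        field_simp
        ring
    _ = 24 * (1 / 2) ^ n * (1 + L * (9 / 8) ^ n) ^ 3 := by
        have e5 : (4:ℝ) ^ n * (2 ^ n)⁻¹ * (4 ^ n)⁻¹ = (1 / 2) ^ n := by
          rw [mul_right_comm, mul_inv_cancel₀ (by positivity), one_mul, one_div, inv_pow]
        rw [e2, e5]
    _ ≤ 24 * (1 / 2) ^ n * ((9 / 8) ^ n * (1 + L)) ^ 3 := by gcongr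
    _ = 24 * (1 + L) ^ 3 * ((1 / 2) ^ n * ((9 / 8) ^ n) ^ 3) := by ring
    _ = _ := by
        rw [← pow_mul, mul_comm n 3, pow_mul, ← mul_pow]; norm_num

lemma large_part (hw : chainS w ≠ ⊤) (hw0 : ∀ s : ℝ, s ∉ Set.Ioo 0 1 → w s = 0)
    {R : ℝ} (hR : 1 ≤ R) :
    ∫⁻ t in Set.Ici (R ^ 2), ENNReal.ofReal (wt t) * volume (goodX R t w) ≤
      ENNReal.ofReal (96 * (1 + 3 * chainK w) ^ 3) * kap := by
  have hK := chainK_nonneg w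
  have hcov : Set.Ici (R ^ 2) ⊆ ⋃ n : ℕ, Set.Ico (R ^ 2 * 4 ^ n) (R ^ 2 * 4 ^ (n + 1)) := by
    intro t ht
    have hR2 : 0 < R ^ 2 := by positivity
    obtain ⟨n, h1, h2⟩ := exists_nat_pow_near (x := t / R ^ 2) (y := (4:ℝ))
      ((one_le_div hR2).2 ht) (by norm_num)
    rw [le_div_iff₀ hR2] at h1
    rw [div_lt_iff₀ hR2] at h2
    exact Set.mem_iUnion.2 ⟨n, by linarith, by linarith⟩
  refine (lintegral_mono_set hcov).trans ?_
  refine (lintegral_iUnion_le _ _).trans ?_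
  refine (ENNReal.tsum_le_tsum (large_piece w hw hw0 hR)).trans ?_
  rw [ENNReal.tsum_mul_right, ← ENNReal.ofReal_tsum_of_nonneg]
  · gcongr
    rw [tsum_mul_left, tsum_geometric_of_lt_one (by norm_num) (by norm_num)]
    have : 0 ≤ (1 + 3 * chainK w) ^ 3 := by positivity
    norm_num
    linarith
  · intro n; positivity
  · exact (summable_geometric_of_lt_one (by norm_num) (by norm_num)).mul_left _

lemma det_bound (hw : chainS w ≠ ⊤) (hw0 : ∀ s : ℝ, s ∉ Set.Ioo 0 1 → w s = 0)
    {R : ℝ} (hR : 1 ≤ R) :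
    ∫⁻ t in Set.Ioi 0, ENNReal.ofReal (wt t) * volume (goodX R t w) ≤
      ENNReal.ofReal (17000 * R ^ 2) * kap * ENNReal.ofReal (2 ^ 11) *
        (1 + ENNReal.ofReal (3 ^ 12) * chainS w) := by
  have hK := chainK_nonneg w
  have hcov : Set.Ioi (0:ℝ) ⊆ Set.Ioo 0 (R ^ 2) ∪ Set.Ici (R ^ 2) := by
    intro t ht
    rcases lt_or_ge t (R ^ 2) with h | h
    · exact Or.inl ⟨ht, h⟩
    · exact Or.inr h
  refine (lintegral_mono_set hcov).trans ?_
  refine (lintegral_union_le _ _ _).trans ?_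
  refine (add_le_add (small_part w hw hw0 hR) (large_part w hw hw0 hR)).trans ?_
  have hS : chainS w = ENNReal.ofReal (chainK w ^ 12) := by
    rw [chainK_pow, ENNReal.ofReal_toReal hw]
  rw [hS, ← add_mul, ← ENNReal.ofReal_add (by positivity) (by positivity),
    ← ENNReal.ofReal_mul (by positivity), ← ENNReal.ofReal_one,
    ← ENNReal.ofReal_add (by positivity) (by positivity), 
    mul_assoc (_ * kap), ← ENNReal.ofReal_mul (by positivity), mul_assoc _ kap, mul_comm kap,
    kap_assoc (by positivity)]
  apply kap_mono
  set k := chainK w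
  have h1 : (1:ℝ) ≤ 1 + 3 * k := by linarith
  have h3 : (1 + 3 * k) ^ 3 ≤ (1 + 3 * k) ^ 12 := pow_le_pow_right₀ h1 (by norm_num)
  have h5 : (1 + 3 * k) ^ 5 ≤ (1 + 3 * k) ^ 12 := pow_le_pow_right₀ h1 (by norm_num)
  have h12 : (1 + 3 * k) ^ 12 ≤ 2 ^ 11 * (1 ^ 12 + (3 * k) ^ 12) :=
    add_pow_le (by norm_num) (by positivity) 12
  have hR2 : 1 ≤ R ^ 2 := one_le_pow₀ hR
  calc 16480 * R ^ 2 * (1 + 3 * k) ^ 5 + 96 * (1 + 3 * k) ^ 3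
      ≤ 16480 * R ^ 2 * (1 + 3 * k) ^ 12 + 96 * R ^ 2 * (1 + 3 * k) ^ 12 := by
        have : (96:ℝ) ≤ 96 * R ^ 2 := by linarith
        gcongr
    _ ≤ 17000 * R ^ 2 * (1 + 3 * k) ^ 12 := by
        have : 0 ≤ R ^ 2 * (1 + 3 * k) ^ 12 := by positivity
        linarith
    _ ≤ 17000 * R ^ 2 * (2 ^ 11 * (1 ^ 12 + (3 * k) ^ 12)) := by gcongr
    _ = _ := by ring

end det

lemma measurableSet_goodSet (R : ℝ) : MeasurableSet (goodSet R) := by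
  have h : goodSet R = (⋃ s : ℚ, ⋃ u : ℚ, {f : ℝ → E3 | 1 / 2 < dist (f s) (f u)}) ∩
      ⋃ s : ℚ, {f : ℝ → E3 | |‖f s‖ - R| < 1} := by
    ext f
    simp [goodSet]
  rw [h]
  refine MeasurableSet.inter (MeasurableSet.iUnion fun s => MeasurableSet.iUnion fun u => ?_)
    (MeasurableSet.iUnion fun s => ?_)
  · exact measurableSet_lt measurable_const
      ((measurable_pi_apply _).dist (measurable_pi_apply _))
  · refine measurableSet_lt ?_ measurable_const
    exact (((measurable_pi_apply (s:ℝ)).norm).sub_const R).abs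

lemma measurable_joint_eval : Measurable (fun p : C(ℝ, E3) × ℝ => p.1 p.2) := by
  have : Continuous (fun p : C(ℝ, E3) × ℝ => p.1 p.2) := by fun_prop
  exact this.measurable

lemma measurable_joint_scale :
    Measurable (fun p : E3 × (ℝ × C(ℝ, E3)) => (fun s : ℝ => scalePath p.1 p.2.1 p.2.2 s)) := by
  refine measurable_pi_lambda _ fun s => ?_
  simp only [scalePath_apply]
  have h1 : Measurable (fun p : E3 × (ℝ × C(ℝ, E3)) => p.2.2 (s / p.2.1)) :=
    measurable_joint_eval.comp
      (f := fun p : E3 × (ℝ × C(ℝ, E3)) => (p.2.2, s / p.2.1)) (by fun_prop)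
  have h2 : Measurable (fun p : E3 × (ℝ × C(ℝ, E3)) => √p.2.1) := by fun_prop
  exact measurable_fst.add (h2.smul h1)

lemma event_subset {R : ℝ} :
    {w : C(ℝ, E3) | 1 ≤ Metric.diam (Set.range w) ∧ ∃ s : ℝ, ‖w s‖ = R} ⊆
      (fun w : C(ℝ, E3) => (fun s : ℝ => w s)) ⁻¹' goodSet R := by
  rintro w ⟨hd, s, hs⟩
  have hdense : DenseRange ((↑) : ℚ → ℝ) := Rat.denseRange_cast
  refine ⟨?_, ?_⟩
  · have hex : ∃ a b : ℝ, 1 / 2 < dist (w a) (w b) := by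
      by_contra hcon
      push Not at hcon
      have : Metric.diam (Set.range w) ≤ 1 / 2 := by
        refine Metric.diam_le_of_forall_dist_le (by norm_num) ?_
        rintro _ ⟨a, rfl⟩ _ ⟨b, rfl⟩
        exact hcon a b
      linarith
    obtain ⟨a, b, hab⟩ := hex
    have ho : IsOpen {p : ℝ × ℝ | 1 / 2 < dist (w p.1) (w p.2)} :=
      isOpen_lt continuous_const (by fun_prop)
    obtain ⟨q, hq⟩ := (hdense.prodMap hdense).exists_mem_open ho ⟨(a, b), hab⟩
    exact ⟨q.1, q.2, hq⟩
  · have ho : IsOpen {a : ℝ | |‖w a‖ - R| < 1} := isOpen_lt (by fun_prop) continuous_const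
    obtain ⟨q, hq⟩ := hdense.exists_mem_open ho ⟨s, by simp [hs]⟩
    exact ⟨q, hq⟩

lemma tonelli {Q : Measure C(ℝ, E3)} [IsProbabilityMeasure Q] (R : ℝ) :
    ∫⁻ x, ∫⁻ t in Set.Ioi (0:ℝ), ENNReal.ofReal (wt t) * Q {w | x ∈ goodX R t w} =
      ∫⁻ w, (∫⁻ t in Set.Ioi (0:ℝ), ENNReal.ofReal (wt t) * volume (goodX R t w)) ∂Q := by
  set S : Set (E3 × (ℝ × C(ℝ, E3))) :=
    (fun p => (fun s : ℝ => scalePath p.1 p.2.1 p.2.2 s)) ⁻¹' goodSet R with hS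
  have hSm : MeasurableSet S := measurable_joint_scale (measurableSet_goodSet R)
  have hwt : Measurable wt := by unfold wt; fun_prop
  set f : E3 × (ℝ × C(ℝ, E3)) → ENNReal :=
    fun p => ENNReal.ofReal (wt p.2.1) * S.indicator (fun _ => 1) p with hf
  have hfm : Measurable f := by
    refine Measurable.mul ?_ (measurable_const.indicator hSm)
    exact (hwt.comp (measurable_fst.comp measurable_snd)).ennreal_ofReal
  have e1 : ∀ x t, ENNReal.ofReal (wt t) * Q {w | x ∈ goodX R t w} = ∫⁻ w, f (x, (t, w)) ∂Q := by
    intro x t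
    have hm : MeasurableSet {w | x ∈ goodX R t w} :=
      (show Measurable fun w : C(ℝ, E3) => (x, (t, w)) by fun_prop) hSm
    simp only [hf]
    rw [lintegral_const_mul' _ _ ENNReal.ofReal_ne_top, ← lintegral_indicator_one hm]
    rfl
  have e2 : ∀ t w, ENNReal.ofReal (wt t) * volume (goodX R t w) = ∫⁻ x, f (x, (t, w)) := by
    intro t w
    have hm : MeasurableSet (goodX R t w) :=
      (show Measurable fun x : E3 => (x, (t, w)) by fun_prop) hSm
    simp only [hf]
    rw [lintegral_const_mul' _ _ ENNReal.ofReal_ne_top, ← lintegral_indicator_one hm]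
    rfl
  simp only [e1, e2]
  calc ∫⁻ x, ∫⁻ t in Set.Ioi (0:ℝ), ∫⁻ w, f (x, (t, w)) ∂Q
      = ∫⁻ x, ∫⁻ p, f (x, p) ∂((volume.restrict (Set.Ioi (0:ℝ))).prod Q) := by
        refine lintegral_congr fun x => ?_
        have hx : Measurable fun p : ℝ × C(ℝ, E3) => f (x, p) := hfm.comp measurable_prodMk_left
        rw [lintegral_prod _ hx.aemeasurable]
    _ = ∫⁻ p, (∫⁻ x, f (x, p)) ∂((volume.restrict (Set.Ioi (0:ℝ))).prod Q) :=
        lintegral_lintegral_swap (f := fun x p => f (x, p)) hfm.aemeasurable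
    _ = _ := by
        rw [lintegral_prod_symm _ (hfm.lintegral_prod_left').aemeasurable]

/-- **Loops of diameter ≥ 1 hitting a large sphere.** There is a constant `C > 0` such that
for all `R ≥ 1`, the Brownian loop measure in `ℝ³` of the set of loops of diameter at least
`1` which intersect the sphere `∂B(0,R)` is at most `C·R²`. -/
theorem loop_measure_sphere_bound
    (μ : Measure C(ℝ, EuclideanSpace ℝ (Fin 3))) (hμ : IsBrownianLoopMeasure μ) :
    ∃ C : ℝ, 0 < C ∧ ∀ R : ℝ, 1 ≤ R →
      μ {w | 1 ≤ Metric.diam (Set.range w) ∧ ∃ s : ℝ, ‖w s‖ = R}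
        ≤ ENNReal.ofReal (C * R ^ 2) := by
  obtain ⟨Q, hQ, hform⟩ := hμ
  have hQ0 := hQ 0 1 one_pos
  have hP := hQ0.1
  set M : ENNReal := kap * ENNReal.ofReal (2 ^ 11) *
    (1 + ENNReal.ofReal (3 ^ 12) * ∫⁻ w, chainS w ∂(Q 0 1)) with hM
  have hchain := lintegral_chainS hQ0
  have hMt : M ≠ ⊤ := by
    refine ENNReal.mul_ne_top (ENNReal.mul_ne_top kap_ne_top ENNReal.ofReal_ne_top) ?_
    exact ENNReal.add_ne_top.2 ⟨ENNReal.one_ne_top, ENNReal.mul_ne_top ENNReal.ofReal_ne_top hchain⟩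
  refine ⟨17000 * M.toReal + 1, by positivity, fun R hR => ?_⟩
  refine (measure_mono event_subset).trans ?_
  rw [hform _ (measurable_path_coe (measurableSet_goodSet R))]
  have hker : ∀ x : E3, ∀ t ∈ Set.Ioi (0:ℝ),
      ENNReal.ofReal (t⁻¹ * (2 * π * t) ^ (-(3:ℝ)/2)) *
        Q x t ((fun w : C(ℝ, E3) => (fun s : ℝ => w s)) ⁻¹' goodSet R) =
      ENNReal.ofReal (wt t) * Q 0 1 {w | x ∈ goodX R t w} := by
    intro x t ht
    have hmap := bridge_map_eq (hQ x t ht) (bridge_scale hQ0 x ht)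
    rw [← Measure.map_apply measurable_path_coe (measurableSet_goodSet R), hmap,
      Measure.map_apply measurable_path_coe (measurableSet_goodSet R),
      Measure.map_apply (measurable_scalePath x t)
        (measurable_path_coe (measurableSet_goodSet R))]
    rfl
  rw [lintegral_congr fun x => setLIntegral_congr_fun measurableSet_Ioi (hker x), tonelli R]
  have hfin : ∀ᵐ w ∂(Q 0 1), chainS w < ⊤ := ae_lt_top measurable_chainS hchain
  have hbound : ∀ᵐ w ∂(Q 0 1),
      ∫⁻ t in Set.Ioi (0:ℝ), ENNReal.ofReal (wt t) * volume (goodX R t w) ≤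
      ENNReal.ofReal (17000 * R ^ 2) * kap * ENNReal.ofReal (2 ^ 11) *
        (1 + ENNReal.ofReal (3 ^ 12) * chainS w) := by
    filter_upwards [hfin, hQ0.2.1] with w h1 h2
    exact det_bound w h1.ne h2.2 hR
  refine (lintegral_mono_ae hbound).trans ?_
  rw [lintegral_const_mul' _ _ (ENNReal.mul_ne_top
      (ENNReal.mul_ne_top ENNReal.ofReal_ne_top kap_ne_top) ENNReal.ofReal_ne_top),
    lintegral_add_left measurable_const, lintegral_const_mul _ measurable_chainS, lintegral_const,
    measure_univ, mul_one, mul_assoc (ENNReal.ofReal _) kap, mul_assoc (ENNReal.ofReal _) (_ * _),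
    ← hM, ← ENNReal.ofReal_toReal hMt, ← ENNReal.ofReal_mul (by positivity)]
  apply ENNReal.ofReal_le_ofReal
  rw [ENNReal.toReal_ofReal ENNReal.toReal_nonneg]
  nlinarith [sq_nonneg R]
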